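/- Let m ≥ 3 be odd, let A(m) be the dihedral-type Artin group with Artin generators a, b, let Δ = (a,b)_m, and let Z = ⟨Δ²⟩ (a central, hence normal, subgroup). Then the quotient A(m)/Z is isomorphic to the free product (ℤ/m) * (ℤ/2) of cyclic groups of orders m and 2, via an isomorphism sending the image of ab to a generator of the ℤ/m factor and the image of Δ to the generator of the ℤ/2 factor. -/

import Mathlib

/-- The alternating product `x y x y ⋯` of length `k`. -/
def altProd {G : Type*} [Monoid G] (x y : G) : ℕ → G
  | 0 => 1
  | Nat.succ k => x * altProd y x k

/-- The relation of the dihedral-type Artin group `A(m)` on generators `a = 0`, `b = 1`: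
`(a,b)_m = (b,a)_m`. -/
def dihedralRel (m : ℕ) : Set (FreeGroup (Fin 2)) :=
  { altProd (FreeGroup.of 0) (FreeGroup.of 1) m *
      (altProd (FreeGroup.of 1) (FreeGroup.of 0) m)⁻¹ }

theorem altProd_two_mul_add_one {G : Type*} [Monoid G] (x y : G) (k : ℕ) :
    altProd x y (2 * k + 1) = (x * y) ^ k * x := by
  induction k with
  | zero => simp [altProd]
  | succ k ih =>
    change x * (y * altProd x y (2 * k + 1)) = _
    rw [ih, pow_succ']
    simp only [mul_assoc]

theorem altProd_two_mul_add_one' {G : Type*} [Monoid G] (x y : G) (k : ℕ) :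
    altProd x y (2 * k + 1) = x * (y * x) ^ k := by
  induction k with
  | zero => simp [altProd]
  | succ k ih =>
    change x * (y * altProd x y (2 * k + 1)) = _
    rw [ih, pow_succ']
    simp only [mul_assoc]

theorem map_altProd {G H : Type*} [Monoid G] [Monoid H] (f : G →* H) (x y : G) (k : ℕ) :
    f (altProd x y k) = altProd (f x) (f y) k := by
  induction k generalizing x y with
  | zero => simp [altProd]
  | succ k ih => simp [altProd, ih]

/-- The homomorphism from the cyclic group of order `n` sending its generator to an element `g`
with `g ^ n = 1`. -/
def zmodPowersHom {G : Type*} [Group G] (n : ℕ) (g : G) (hg : g ^ n = 1) :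
    Multiplicative (ZMod n) →* G :=
  AddMonoidHom.toMultiplicativeLeft
    (ZMod.lift n ⟨zmultiplesHom (Additive G) (Additive.ofMul g), by
      simp [← ofMul_pow, hg]⟩)

theorem zmodPowersHom_ofAdd_one {G : Type*} [Group G] (n : ℕ) (g : G) (hg : g ^ n = 1) :
    zmodPowersHom n g hg (Multiplicative.ofAdd 1) = g := by
  have h := ZMod.lift_coe n ⟨zmultiplesHom (Additive G) (Additive.ofMul g), by
      simp [← ofMul_pow, hg]⟩ 1
  rw [Int.cast_one] at h
  change Additive.toMul (ZMod.lift n _ (1 : ZMod n)) = g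
  rw [h]
  simp

theorem closure_ofAdd_one (n : ℕ) :
    Subgroup.closure {(Multiplicative.ofAdd (1 : ZMod n))} = ⊤ := by
  refine eq_top_iff.2 fun x _ => Subgroup.mem_closure_singleton.2 ?_
  obtain ⟨j, hj⟩ := ZMod.intCast_surjective x.toAdd
  exact ⟨j, by rw [← ofAdd_zsmul, zsmul_one, hj]; rfl⟩

/-- A homomorphism to a free product of cyclic groups is onto if its range contains the
generators of the two factors. -/
theorem surjective_of_mem_range_generators {G : Type*} [Group G] {m n : ℕ}
    (f : G →* Monoid.Coprod (Multiplicative (ZMod m)) (Multiplicative (ZMod n)))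
    (hl : Monoid.Coprod.inl (Multiplicative.ofAdd 1) ∈ f.range)
    (hr : Monoid.Coprod.inr (Multiplicative.ofAdd 1) ∈ f.range) :
    Function.Surjective f := by
  rw [← MonoidHom.range_eq_top, eq_top_iff, ← Monoid.Coprod.range_inl_sup_range_inr, sup_le_iff]
  have key {H : Type _} [Group H] {l : ℕ} (i : Multiplicative (ZMod l) →* H) (K : Subgroup H)
      (h : i (Multiplicative.ofAdd 1) ∈ K) : i.range ≤ K := by
    rw [MonoidHom.range_eq_map, ← closure_ofAdd_one, MonoidHom.map_closure, Subgroup.closure_le]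
    simpa using h
  exact ⟨key _ _ hl, key _ _ hr⟩

/-- The two Artin generators satisfy `Δ ^ 2 = (a b) ^ m`. -/
theorem sq_eq_pow_of_braid {G : Type*} [Group G] {a b : G} {k : ℕ}
    (h : (a * b) ^ k * a = b * (a * b) ^ k) :
    ((a * b) ^ k * a) ^ 2 = (a * b) ^ (2 * k + 1) := by
  rw [sq]
  nth_rw 2 [h]
  rw [two_mul, add_assoc, pow_add, pow_succ']
  simp only [mul_assoc]

theorem altProd_of_eq (m : ℕ) :
    altProd (PresentedGroup.of 0 : PresentedGroup (dihedralRel m)) (PresentedGroup.of 1) m =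
      altProd (PresentedGroup.of 1) (PresentedGroup.of 0) m := by
  have h := PresentedGroup.one_of_mem (rels := dihedralRel m) rfl
  rw [map_mul, map_inv, mul_inv_eq_one, map_altProd, map_altProd] at h
  exact h

/-- For odd `m ≥ 3`, the quotient of the dihedral-type Artin group
`A(m)` by the central subgroup `⟨Δ²⟩` is the free product `(ℤ/m) ∗ (ℤ/2)`, with the image
of `ab` generating the `ℤ/m` factor and the image of `Δ` generating the `ℤ/2` factor:
there is a surjective homomorphism onto the free product with kernel exactly `⟨Δ²⟩`,
sending `ab` and `Δ` to generators of the respective factors. -/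
theorem dihedral_artin_central_quotient_odd (m : ℕ) (hm : 3 ≤ m) (hodd : Odd m) :
    let a : PresentedGroup (dihedralRel m) := PresentedGroup.of 0
    let b : PresentedGroup (dihedralRel m) := PresentedGroup.of 1
    let Δ := altProd a b m
    ∃ ψ : PresentedGroup (dihedralRel m) →*
        Monoid.Coprod (Multiplicative (ZMod m)) (Multiplicative (ZMod 2)),
      Function.Surjective ψ ∧
      ψ.ker = Subgroup.zpowers (Δ ^ 2) ∧
      ψ (a * b) = Monoid.Coprod.inl (Multiplicative.ofAdd (1 : ZMod m)) ∧
      ψ Δ = Monoid.Coprod.inr (Multiplicative.ofAdd (1 : ZMod 2)) := by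
  intro a b Δ
  obtain ⟨k, rfl⟩ := hodd
  have hΔ : Δ = (a * b) ^ k * a := altProd_two_mul_add_one a b k
  have hΔ' : (a * b) ^ k * a = b * (a * b) ^ k := by
    rw [← altProd_two_mul_add_one, ← altProd_two_mul_add_one']
    exact altProd_of_eq _
  have hsq : Δ ^ 2 = (a * b) ^ (2 * k + 1) := hΔ ▸ sq_eq_pow_of_braid hΔ'
  set X : Monoid.Coprod (Multiplicative (ZMod (2 * k + 1))) (Multiplicative (ZMod 2)) :=
    Monoid.Coprod.inl (Multiplicative.ofAdd 1) with hX
  set D : Monoid.Coprod (Multiplicative (ZMod (2 * k + 1))) (Multiplicative (ZMod 2)) :=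
    Monoid.Coprod.inr (Multiplicative.ofAdd 1) with hD
  have hXpow : X ^ (2 * k + 1) = 1 := by
    rw [hX, ← map_pow, ← ofAdd_nsmul, nsmul_one, ZMod.natCast_self, ofAdd_zero, map_one]
  have hDsq : D ^ 2 = 1 := by
    rw [hD, ← map_pow, ← ofAdd_nsmul, nsmul_one, ZMod.natCast_self, ofAdd_zero, map_one]
  let v : Fin 2 → Monoid.Coprod (Multiplicative (ZMod (2 * k + 1))) (Multiplicative (ZMod 2)) :=
    ![(X ^ k)⁻¹ * D, D⁻¹ * X ^ (k + 1)]
  have hv : v 0 * v 1 = X := by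
    simp [v, pow_succ]
  have hvΔ : altProd (v 0) (v 1) (2 * k + 1) = D := by
    rw [altProd_two_mul_add_one, hv]
    simp [v]
  have hvΔ' : altProd (v 1) (v 0) (2 * k + 1) = D := by
    rw [altProd_two_mul_add_one', hv]
    change D⁻¹ * X ^ (k + 1) * X ^ k = D
    rw [mul_assoc, ← pow_add, show k + 1 + k = 2 * k + 1 by ring, hXpow, mul_one,
      inv_eq_iff_mul_eq_one, ← sq, hDsq]
  have hrel : ∀ r ∈ dihedralRel (2 * k + 1), FreeGroup.lift v r = 1 := by
    rintro r rfl
    rw [map_mul, map_inv, map_altProd, map_altProd, FreeGroup.lift_apply_of,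
      FreeGroup.lift_apply_of, hvΔ, hvΔ', mul_inv_cancel]
  let ψ := PresentedGroup.toGroup hrel
  have hψa : ψ a = v 0 := PresentedGroup.toGroup.of hrel
  have hψb : ψ b = v 1 := PresentedGroup.toGroup.of hrel
  have hψab : ψ (a * b) = X := by rw [map_mul, hψa, hψb, hv]
  have hψΔ : ψ Δ = D := by rw [map_altProd, hψa, hψb, hvΔ]
  refine ⟨ψ, surjective_of_mem_range_generators ψ ⟨_, hψab⟩ ⟨_, hψΔ⟩, ?_, hψab, hψΔ⟩
  have ha : a = ((a * b) ^ k)⁻¹ * Δ := by rw [hΔ, inv_mul_cancel_left]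
  have hb : b = Δ⁻¹ * (a * b) ^ (k + 1) := by
    rw [hΔ, pow_succ]
    group
  have hcab : Commute (Δ ^ 2) (a * b) := hsq ▸ (Commute.refl _).pow_left _
  have hcΔ : Commute (Δ ^ 2) Δ := (Commute.refl _).pow_left _
  have hca : Commute (Δ ^ 2) a := by
    rw [ha]
    exact (hcab.pow_right _).inv_right.mul_right hcΔ
  have hcb : Commute (Δ ^ 2) b := by
    rw [hb]
    exact hcΔ.inv_right.mul_right (hcab.pow_right _)
  have hcentral : Δ ^ 2 ∈ Subgroup.center (PresentedGroup (dihedralRel (2 * k + 1))) := by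
    rw [← Subgroup.centralizer_univ, ← Subgroup.coe_top,
      ← PresentedGroup.closure_range_of, Subgroup.centralizer_closure,
      Subgroup.mem_centralizer_iff]
    rintro _ ⟨i, rfl⟩
    fin_cases i
    exacts [hca.symm, hcb.symm]
  have hnormal : (Subgroup.zpowers (Δ ^ 2)).Normal :=
    ⟨fun x hx g => by
      rwa [Subgroup.mem_center_iff.1 (Subgroup.zpowers_le.2 hcentral hx) g,
        mul_inv_cancel_right]⟩
  let π := QuotientGroup.mk' (Subgroup.zpowers (Δ ^ 2))
  have hπΔ : π Δ ^ 2 = 1 := by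
    rw [← map_pow, ← MonoidHom.mem_ker, QuotientGroup.ker_mk']
    exact Subgroup.mem_zpowers _
  have hπab : π (a * b) ^ (2 * k + 1) = 1 := by
    rw [← map_pow, ← hsq, map_pow, hπΔ]
  let φ := Monoid.Coprod.lift (zmodPowersHom _ _ hπab) (zmodPowersHom _ _ hπΔ)
  have hφX : φ X = π (a * b) := by
    rw [hX, Monoid.Coprod.lift_apply_inl, zmodPowersHom_ofAdd_one]
  have hφD : φ D = π Δ := by
    rw [hD, Monoid.Coprod.lift_apply_inr, zmodPowersHom_ofAdd_one]
  have hφψ : φ.comp ψ = π := by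
    refine PresentedGroup.ext fun i => ?_
    fin_cases i
    · change φ (ψ a) = π a
      rw [hψa, ha]
      change φ ((X ^ k)⁻¹ * D) = _
      simp only [map_mul, map_inv, map_pow, hφX, hφD]
    · change φ (ψ b) = π b
      rw [hψb, hb]
      change φ (D⁻¹ * X ^ (k + 1)) = _
      simp only [map_mul, map_inv, map_pow, hφX, hφD]
  refine le_antisymm (fun x hx => ?_) (Subgroup.zpowers_le.2 ?_)
  · rw [← QuotientGroup.ker_mk' (Subgroup.zpowers (Δ ^ 2)), MonoidHom.mem_ker]
    change π x = 1
    rw [← hφψ, MonoidHom.comp_apply, MonoidHom.mem_ker.1 hx, map_one]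
  · rw [MonoidHom.mem_ker, map_pow, hψΔ, hDsq]
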